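/- Fix 0 < p < 1 and a real x > 0 that is not an integer. If t(n) is a sequence of nonnegative integers with t(n) ~ n·p/x as n → ∞ (i.e. t(n)·x/(n·p) → 1), then asymptotically almost surely χ^{t(n)}(G(n,p)) = ⌈x⌉. -/

import Mathlib

open MeasureTheory Filter
open scoped ENNReal NNReal

/-- The Bernoulli(p) measure on `Bool`. -/
noncomputable def bernoulliBool (p : ℝ) : Measure Bool :=
  p.toNNReal • Measure.dirac true + (1 - p).toNNReal • Measure.dirac false

instance (p : ℝ) : IsFiniteMeasure (bernoulliBool p) := by
  unfold bernoulliBool; infer_instance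

instance (n : ℕ) : MeasurableSpace (SimpleGraph (Fin n)) := ⊤

/-- The Erdős–Rényi random graph `G(n,p)`: the distribution of the simple graph on `Fin n`
obtained by including each possible edge independently with probability `p`. -/
noncomputable def erMeasure (n : ℕ) (p : ℝ) : Measure (SimpleGraph (Fin n)) :=
  Measure.map (fun f : Sym2 (Fin n) → Bool => SimpleGraph.fromEdgeSet {e | f e = true})
    (Measure.pi fun _ : Sym2 (Fin n) => bernoulliBool p)

/-- A set `S` of vertices is `t`-dependent if the induced subgraph has maximum degree at most `t`,
i.e. every vertex of `S` has at most `t` neighbours inside `S`. -/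
def IsTDependent {V : Type*} (G : SimpleGraph V) (t : ℕ) (S : Set V) : Prop :=
  ∀ v ∈ S, {u ∈ S | G.Adj v u}.ncard ≤ t

/-- The `t`-improper chromatic number: the least number of colours in a vertex colouring
in which every colour class is `t`-dependent. -/
noncomputable def improperChromaticNumber {V : Type*} (G : SimpleGraph V) (t : ℕ) : ℕ :=
  sInf {k | ∃ c : V → Fin k, ∀ i : Fin k, IsTDependent G t {v | c v = i}}

/-- The `t`-dependence number: the maximum size of a `t`-dependent set. -/
noncomputable def tDependenceNumber {V : Type*} (G : SimpleGraph V) (t : ℕ) : ℕ :=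
  sSup {m | ∃ S : Set V, S.ncard = m ∧ IsTDependent G t S}

/-- The Fenchel–Legendre transform `Λ*(x) = x ln(x/p) + (1-x) ln((1-x)/(1-p))`
(with the conventions `Λ*(0) = ln(1/(1-p))`, `Λ*(1) = ln(1/p)`, which hold automatically
since `Real.log 0 = 0` in Lean). -/
noncomputable def LambdaStar (p x : ℝ) : ℝ :=
  x * Real.log (x / p) + (1 - x) * Real.log ((1 - x) / (1 - p))

open ProbabilityTheory

instance isProbabilityMeasure_bernoulliBool (p : unitInterval) :
    IsProbabilityMeasure (bernoulliBool p) := by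
  constructor
  have h : (p : ℝ).toNNReal + (1 - (p : ℝ)).toNNReal = 1 := by
    rw [← Real.toNNReal_add p.2.1 (by linarith [p.2.2])]
    simp
  simp only [bernoulliBool, Measure.add_apply, Measure.smul_apply, measure_univ]
  simpa [ENNReal.smul_def] using congrArg ((↑) : ℝ≥0 → ℝ≥0∞) h

/-- The centred indicator of `true` under the Bernoulli measure. -/
noncomputable def centredIndicator (p : ℝ) (b : Bool) : ℝ := (if b then 1 else 0) - p

lemma integral_centredIndicator (p : unitInterval) :
    ∫ b, centredIndicator p b ∂(bernoulliBool p) = 0 := by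
  rw [integral_fintype (Integrable.of_finite)]
  have h1 : (0 : ℝ) ≤ 1 - p := by linarith [p.2.2]
  have ht : (bernoulliBool p).real {true} = p := by
    rw [bernoulliBool, measureReal_def, Measure.add_apply, Measure.smul_apply, Measure.smul_apply]
    simp [ENNReal.smul_def, p.2.1]
  have hf : (bernoulliBool p).real {false} = 1 - p := by
    rw [bernoulliBool, measureReal_def, Measure.add_apply, Measure.smul_apply, Measure.smul_apply]
    simp [ENNReal.smul_def, h1]
  simp only [Fintype.sum_bool, ht, hf, centredIndicator, smul_eq_mul, if_true, if_false,
    Bool.false_eq_true]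
  ring

lemma hasSubgaussianMGF_centredIndicator (p : unitInterval) :
    HasSubgaussianMGF (centredIndicator p) (1 / 4) (bernoulliBool p) := by
  have h := hasSubgaussianMGF_of_mem_Icc_of_integral_eq_zero (μ := bernoulliBool p)
    (X := centredIndicator p) (a := -p) (b := 1 - p) (measurable_of_finite _).aemeasurable
    (.of_forall fun b ↦ by
      have h0 := p.2.1
      have h1 := p.2.2
      cases b <;> simp [centredIndicator]) (integral_centredIndicator p)
  convert h using 1
  ext
  norm_num

/-- The product Bernoulli measure on edge indicators, from which `erMeasure` is obtained. -/
noncomputable abbrev edgeMeasure (n : ℕ) (p : ℝ) : Measure (Sym2 (Fin n) → Bool) :=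
  Measure.pi fun _ => bernoulliBool p

lemma hasSubgaussianMGF_edge {n : ℕ} (p : unitInterval) (e : Sym2 (Fin n)) :
    HasSubgaussianMGF (fun f : Sym2 (Fin n) → Bool => centredIndicator p (f e)) (1 / 4)
      (edgeMeasure n p) := by
  have hmap : (edgeMeasure n p).map (fun f => f e) = bernoulliBool p :=
    (measurePreserving_eval (fun _ : Sym2 (Fin n) => bernoulliBool p) e).map_eq
  refine HasSubgaussianMGF.of_map (X := centredIndicator p)
    (Y := fun f : Sym2 (Fin n) → Bool => f e)
    (measurable_pi_apply e).aemeasurable ?_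
  rw [hmap]
  exact hasSubgaussianMGF_centredIndicator p

lemma iIndepFun_edge {n : ℕ} (p : unitInterval) :
    iIndepFun (fun (e : Sym2 (Fin n)) (f : Sym2 (Fin n) → Bool) => centredIndicator p (f e))
      (edgeMeasure n p) :=
  iIndepFun_pi (X := fun _ => centredIndicator p) fun _ => (measurable_of_finite _).aemeasurable

lemma sum_centredIndicator {ι : Type*} (p : ℝ) (E : Finset ι) (f : ι → Bool) :
    ∑ e ∈ E, centredIndicator p (f e) = (E.filter (fun e => f e = true)).card - p * E.card := by
  simp [centredIndicator, Finset.sum_sub_distrib, mul_comm]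

/-- Hoeffding upper tail for the number of edges of `G(n,p)` in a fixed set of pairs. -/
lemma edgeMeasure_upper_tail {n : ℕ} (p : unitInterval) (E : Finset (Sym2 (Fin n))) {ε : ℝ}
    (hε : 0 ≤ ε) :
    (edgeMeasure n p).real {f | (p : ℝ) * E.card + ε ≤ (E.filter (fun e => f e = true)).card} ≤
      Real.exp (-(2 * ε ^ 2 / E.card)) := by
  have h := HasSubgaussianMGF.measure_sum_ge_le_of_iIndepFun (iIndepFun_edge (n := n) p)
    (s := E) (fun e _ => hasSubgaussianMGF_edge p e) hε
  simp only [sum_centredIndicator] at h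
  convert h using 2
  · ext f
    simp only [Set.mem_ofPred_eq]
    constructor <;> intro h <;> linarith
  · simp
    ring

/-- Hoeffding lower tail for the number of edges of `G(n,p)` in a fixed set of pairs. -/
lemma edgeMeasure_lower_tail {n : ℕ} (p : unitInterval) (E : Finset (Sym2 (Fin n))) {ε : ℝ}
    (hε : 0 ≤ ε) :
    (edgeMeasure n p).real {f | (E.filter (fun e => f e = true)).card ≤ (p : ℝ) * E.card - ε} ≤
      Real.exp (-(2 * ε ^ 2 / E.card)) := by
  have h := HasSubgaussianMGF.measure_sum_ge_le_of_iIndepFun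
    ((iIndepFun_edge (n := n) p).comp (fun _ x => -x) fun _ => measurable_neg)
    (s := E) (fun e _ => (hasSubgaussianMGF_edge p e).neg) hε
  simp only [Function.comp_apply, Finset.sum_neg_distrib, sum_centredIndicator] at h
  convert h using 2
  · ext f
    simp only [Set.mem_ofPred_eq]
    constructor <;> intro h <;> linarith
  · simp
    ring

/-- The graph determined by edge indicators. -/
abbrev graphOfIndicator {n : ℕ} (f : Sym2 (Fin n) → Bool) : SimpleGraph (Fin n) :=
  SimpleGraph.fromEdgeSet {e | f e = true}

lemma erMeasure_real_apply (n : ℕ) (p : ℝ) (A : Set (SimpleGraph (Fin n))) :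
    (erMeasure n p).real A = (edgeMeasure n p).real {f | graphOfIndicator f ∈ A} := by
  rw [Measure.real, erMeasure, Measure.map_apply (measurable_of_finite _) MeasurableSpace.measurableSet_top]
  rfl

instance isProbabilityMeasure_erMeasure (n : ℕ) (p : unitInterval) :
    IsProbabilityMeasure (erMeasure n p) :=
  Measure.isProbabilityMeasure_map (measurable_of_finite _).aemeasurable

lemma improperChromaticNumber_le {V : Type*} {G : SimpleGraph V} {t k : ℕ} (c : V → Fin k)
    (hc : ∀ i, IsTDependent G t {v | c v = i}) : improperChromaticNumber G t ≤ k :=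
  Nat.sInf_le ⟨c, hc⟩

lemma exists_improperColouring {n : ℕ} (G : SimpleGraph (Fin n)) (t : ℕ) :
    ∃ c : Fin n → Fin (improperChromaticNumber G t), ∀ i, IsTDependent G t {v | c v = i} := by
  refine Nat.sInf_mem (s := {k | ∃ c : Fin n → Fin k, ∀ i, IsTDependent G t {v | c v = i}})
    ⟨n, id, ?_⟩
  rintro i v rfl
  have : {u ∈ {v' | id v' = id v} | G.Adj v u} = ∅ := by
    ext u
    simp only [id, Set.mem_ofPred_eq, Set.mem_empty_iff_false, iff_false, not_and]
    rintro rfl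
    exact G.irrefl
  rw [this]
  simp

/-- A graph on `n > 0` vertices whose `t`-improper chromatic number is at most `k` has a
`t`-dependent set of at least `n / k` vertices. -/
lemma exists_large_tDependent {n t k : ℕ} (hn : 0 < n) {G : SimpleGraph (Fin n)}
    (hG : improperChromaticNumber G t ≤ k) :
    ∃ S : Finset (Fin n), IsTDependent G t S ∧ n ≤ k * S.card := by
  obtain ⟨c, hc⟩ := exists_improperColouring G t
  have : Nonempty (Fin (improperChromaticNumber G t)) := ⟨c ⟨0, hn⟩⟩
  by_contra! hS
  have hlt : ∀ i, k * (Finset.univ.filter (fun v => c v = i)).card < n := fun i => by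
    refine hS _ ?_
    simpa using hc i
  have hsum : n = ∑ i, (Finset.univ.filter (fun v => c v = i)).card := by
    simpa using Finset.card_eq_sum_card_fiberwise (s := Finset.univ) (t := Finset.univ) (f := c)
      (by simp)
  have h2 : ∑ i, k * (Finset.univ.filter (fun v => c v = i)).card <
      ∑ _i : Fin (improperChromaticNumber G t), n :=
    Finset.sum_lt_sum_of_nonempty Finset.univ_nonempty fun i _ => hlt i
  rw [← Finset.mul_sum, ← hsum, Finset.sum_const, Finset.card_univ, Fintype.card_fin,
    smul_eq_mul] at h2
  exact absurd (Nat.mul_le_mul_right n hG) (not_le.mpr h2)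

/-- The pairs of distinct elements of a set of vertices. -/
def innerPairs {n : ℕ} (S : Finset (Fin n)) : Finset (Sym2 (Fin n)) :=
  S.offDiag.image Sym2.mk.uncurry

lemma two_mul_card_innerPairs {n : ℕ} (S : Finset (Fin n)) :
    2 * ((innerPairs S).card : ℝ) = S.card * (S.card - 1) := by
  have h : 2 * (innerPairs S).card = S.offDiag.card := Sym2.two_mul_card_image_offDiag S
  have h2 : S.offDiag.card + S.card = S.card * S.card := by
    rw [Finset.offDiag_card]
    exact Nat.sub_add_cancel (Nat.le_mul_self _)
  have h3 : (2 * (innerPairs S).card + S.card : ℝ) = S.card * S.card := by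
    exact_mod_cast h ▸ h2
  linarith

lemma two_mul_card_edges_le {n t : ℕ} {f : Sym2 (Fin n) → Bool} {S : Finset (Fin n)}
    (hS : IsTDependent (graphOfIndicator f) t S) :
    2 * ((innerPairs S).filter (fun e => f e = true)).card ≤ t * S.card := by
  set D := S.offDiag.filter (fun q => f s(q.1, q.2) = true) with hD
  have h1 : 2 * ((innerPairs S).filter (fun e => f e = true)).card ≤ D.card := by
    have himg : (innerPairs S).filter (fun e => f e = true) = D.image Sym2.mk.uncurry := by
      rw [innerPairs, Finset.filter_image]
      rfl
    rw [himg]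
    refine Finset.mul_card_image_le_card _ _ fun e he => ?_
    obtain ⟨⟨u, v⟩, huv, rfl⟩ := Finset.mem_image.mp he
    simp only [hD, Finset.mem_filter, Finset.mem_offDiag] at huv
    obtain ⟨⟨hu, hv, hne⟩, hf⟩ := huv
    have hne' : ((u, v) : Fin n × Fin n) ≠ (v, u) := by simp [hne]
    rw [← Finset.card_pair hne']
    refine Finset.card_le_card ?_
    intro q hq
    have hf' : f s(v, u) = true := Sym2.eq_swap (a := u) ▸ hf
    simp only [Finset.mem_insert, Finset.mem_singleton] at hq
    rcases hq with rfl | rfl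
    · simp [hD, hu, hv, hne, hf]
    · simp [hD, hu, hv, hne.symm, hf', Sym2.eq_swap (a := u)]
  have h2 : D.card ≤ S.card * t := by
    refine Finset.card_le_mul_card_image_of_maps_to (f := Prod.fst) (t := S) ?_ t ?_ |>.trans
      (mul_comm _ _).le
    · intro q hq
      simp only [hD, Finset.mem_filter, Finset.mem_offDiag] at hq
      exact hq.1.1
    · intro v hv
      refine le_trans ?_ (hS v hv)
      rw [Set.ncard_eq_toFinset_card']
      refine Finset.card_le_card_of_injOn Prod.snd ?_ ?_
      · rintro ⟨a, b⟩ hq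
        simp only [hD, Finset.coe_filter, Finset.mem_filter, Finset.mem_offDiag,
          Set.mem_ofPred_eq] at hq
        obtain ⟨⟨⟨-, hb, hne⟩, hf⟩, rfl⟩ := hq
        simpa [hb, hne] using hf
      · rintro ⟨a, b⟩ hq ⟨a', b'⟩ hq' h
        simp only [Finset.coe_filter, Set.mem_ofPred_eq] at hq hq'
        simp_all
  rw [mul_comm t]
  exact h1.trans h2

lemma erMeasure_improperChromaticNumber_le {n t k : ℕ} (p : unitInterval) {δ : ℝ} (hδ : 0 < δ)
    (hk : 0 < k) (hn : 2 * k ≤ n) (ht : (t : ℝ) ≤ p * (n / k) - p - δ * n) :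
    (erMeasure n p).real {G | improperChromaticNumber G t ≤ k} ≤
      2 ^ n * Real.exp (-(δ ^ 2 * n ^ 2)) := by
  have hk' : (0 : ℝ) < k := by exact_mod_cast hk
  rw [erMeasure_real_apply]
  set L : Finset (Finset (Fin n)) := Finset.univ.filter (fun S => n ≤ k * S.card) with hL
  have hsub : {f : Sym2 (Fin n) → Bool |
      graphOfIndicator f ∈ {G | improperChromaticNumber G t ≤ k}} ⊆
      ⋃ S ∈ L, {f | ((innerPairs S).filter (fun e => f e = true)).card ≤
        (p : ℝ) * (innerPairs S).card - δ * n * S.card / 2} := by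
    intro f hf
    obtain ⟨S, hS, hcard⟩ := exists_large_tDependent (by lia) hf
    simp only [Set.mem_iUnion, Set.mem_ofPred_eq]
    refine ⟨S, by simpa [hL] using hcard, ?_⟩
    have h1 : 2 * (((innerPairs S).filter (fun e => f e = true)).card : ℝ) ≤ t * S.card := by
      exact_mod_cast two_mul_card_edges_le hS
    have h2 := two_mul_card_innerPairs S
    have h3 : (n : ℝ) / k ≤ S.card := by
      rw [div_le_iff₀ hk', mul_comm]
      exact_mod_cast hcard
    have h4 : (t : ℝ) ≤ p * (S.card - 1) - δ * n := by
      have := mul_le_mul_of_nonneg_left h3 p.2.1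
      linarith
    have h5 := mul_le_mul_of_nonneg_right h4 (Nat.cast_nonneg (α := ℝ) S.card)
    have h6 : (p : ℝ) * (2 * (innerPairs S).card) = p * (S.card * (S.card - 1)) := by rw [h2]
    linarith
  refine (measureReal_mono hsub (measure_ne_top _ _)).trans
    ((measureReal_biUnion_finset_le _ _).trans ?_)
  have hterm : ∀ S ∈ L, (edgeMeasure n p).real
      {f | ((innerPairs S).filter (fun e => f e = true)).card ≤
        (p : ℝ) * (innerPairs S).card - δ * n * S.card / 2} ≤ Real.exp (-(δ ^ 2 * n ^ 2)) := by
    intro S hS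
    refine (edgeMeasure_lower_tail p (innerPairs S) (by positivity)).trans ?_
    have hcard : n ≤ k * S.card := by simpa [hL] using hS
    have hs2 : 2 ≤ S.card := by
      by_contra! h
      have : k * S.card ≤ k * 1 := Nat.mul_le_mul_left k (by lia)
      lia
    have hs : (2 : ℝ) ≤ S.card := by exact_mod_cast hs2
    have h2 := two_mul_card_innerPairs S
    have hpos : (0 : ℝ) < (innerPairs S).card := by nlinarith
    rw [Real.exp_le_exp, neg_le_neg_iff, le_div_iff₀ hpos]
    have h3 : 2 * ((innerPairs S).card : ℝ) ≤ S.card ^ 2 := by nlinarith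
    have h4 := mul_le_mul_of_nonneg_left h3 (by positivity : 0 ≤ δ ^ 2 * (n : ℝ) ^ 2)
    nlinarith
  refine (Finset.sum_le_card_nsmul _ _ _ hterm).trans ?_
  rw [nsmul_eq_mul]
  refine mul_le_mul_of_nonneg_right ?_ (Real.exp_nonneg _)
  have : L.card ≤ 2 ^ n := (Finset.card_le_univ L).trans (by simp)
  exact_mod_cast this

lemma exists_balanced_colouring (n : ℕ) {k : ℕ} (hk : 0 < k) :
    ∃ c : Fin n → Fin k, ∀ i, (Finset.univ.filter (fun v => c v = i)).card ≤ n / k + 1 := by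
  refine ⟨fun v => ⟨v % k, Nat.mod_lt _ hk⟩, fun i => ?_⟩
  have h : (Finset.univ.filter
      (fun v : Fin n => (⟨v % k, Nat.mod_lt _ hk⟩ : Fin k) = i)).card ≤
      n.count (fun m => m ≡ i [MOD k]) := by
    rw [Nat.count_eq_card_filter_range]
    refine Finset.card_le_card_of_injOn Fin.val ?_ Fin.val_injective.injOn
    intro v hv
    simp only [Finset.coe_filter, Finset.mem_univ, true_and, Set.mem_ofPred_eq, Fin.ext_iff] at hv
    simp [Nat.ModEq, hv, Nat.mod_eq_of_lt i.2]
  refine h.trans ?_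
  rw [Nat.count_modEq_card _ hk]
  split_ifs <;> lia

lemma erMeasure_lt_improperChromaticNumber {n t k : ℕ} (p : unitInterval) {δ : ℝ} (hδ : 0 < δ)
    (hk : 0 < k) (ht : (p : ℝ) * (n / k + 1) + δ * n ≤ t) :
    (erMeasure n p).real {G | k < improperChromaticNumber G t} ≤
      n * Real.exp (-(2 * δ ^ 2 * n)) := by
  obtain ⟨c, hc⟩ := exists_balanced_colouring n hk
  rw [erMeasure_real_apply]
  set C : Fin n → Finset (Fin n) := fun v => Finset.univ.filter (fun u => c u = c v) with hC
  set E : Fin n → Finset (Sym2 (Fin n)) := fun v => (C v).image (fun u => s(v, u)) with hE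
  have hEC : ∀ v, (E v).card ≤ (C v).card := fun v => Finset.card_image_le
  have hsub : {f : Sym2 (Fin n) → Bool |
      graphOfIndicator f ∈ {G | k < improperChromaticNumber G t}} ⊆
      ⋃ v ∈ (Finset.univ : Finset (Fin n)),
        {f | (p : ℝ) * (E v).card + δ * n ≤ ((E v).filter (fun e => f e = true)).card} := by
    intro f hf
    by_contra hcon
    simp only [Finset.mem_univ, Set.iUnion_true, Set.mem_iUnion, Set.mem_ofPred_eq, not_exists,
      not_le] at hcon
    refine absurd (improperChromaticNumber_le c ?_) (not_le.mpr hf)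
    rintro i v rfl
    have h1 : {u ∈ {v' | c v' = c v} | (graphOfIndicator f).Adj v u}.ncard ≤
        ((E v).filter (fun e => f e = true)).card := by
      rw [Set.ncard_eq_toFinset_card']
      refine Finset.card_le_card_of_injOn (fun u => s(v, u)) ?_ ?_
      · intro u hu
        simp only [SimpleGraph.fromEdgeSet_adj, Set.mem_ofPred_eq, Set.coe_toFinset] at hu
        simp only [Finset.coe_filter, Set.mem_ofPred_eq, hE, hC]
        exact ⟨Finset.mem_image_of_mem _ (by simp [hu.1]), hu.2.1⟩
      · intro u _ w _ h
        exact Sym2.congr_right.mp h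
    have h2 : ((E v).card : ℝ) ≤ n / k + 1 := by
      have : ((E v).card : ℝ) ≤ (n / k : ℕ) + 1 := by exact_mod_cast (hEC v).trans (hc _)
      have h3 : ((n / k : ℕ) : ℝ) ≤ n / k := Nat.cast_div_le
      linarith
    have h4 := mul_le_mul_of_nonneg_left h2 p.2.1
    have h5 := hcon v
    have h6 : (((E v).filter (fun e => f e = true)).card : ℝ) < t := by linarith
    exact h1.trans (by exact_mod_cast h6.le)
  refine (measureReal_mono hsub (measure_ne_top _ _)).trans
    ((measureReal_biUnion_finset_le _ _).trans ?_)
  have hterm : ∀ v ∈ (Finset.univ : Finset (Fin n)), (edgeMeasure n p).real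
      {f | (p : ℝ) * (E v).card + δ * n ≤ ((E v).filter (fun e => f e = true)).card} ≤
      Real.exp (-(2 * δ ^ 2 * n)) := by
    intro v _
    refine (edgeMeasure_upper_tail p (E v) (by positivity)).trans ?_
    have hpos : (0 : ℝ) < (E v).card := by
      rw [Nat.cast_pos, Finset.card_pos]
      exact ⟨s(v, v), Finset.mem_image_of_mem _ (by simp [hC])⟩
    rw [Real.exp_le_exp, neg_le_neg_iff, le_div_iff₀ hpos]
    have hle : ((E v).card : ℝ) ≤ n := by
      exact_mod_cast (hEC v).trans ((Finset.card_le_univ _).trans (by simp))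
    have := mul_le_mul_of_nonneg_left hle (by positivity : 0 ≤ 2 * δ ^ 2 * (n : ℝ))
    linarith
  simpa using Finset.sum_le_card_nsmul _ _ _ hterm

lemma tendsto_nat_mul_exp_neg {a : ℝ} (ha : 0 < a) :
    Tendsto (fun n : ℕ => (n : ℝ) * Real.exp (-(a * n))) atTop (nhds 0) := by
  have h := (Real.tendsto_pow_mul_exp_neg_atTop_nhds_zero 1).comp
    (tendsto_natCast_atTop_atTop.const_mul_atTop ha)
  have h2 := h.const_mul a⁻¹
  rw [mul_zero] at h2
  refine h2.congr fun n => ?_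
  simp only [Function.comp_apply, pow_one]
  field_simp

lemma tendsto_two_pow_mul_exp_neg_sq {a : ℝ} (ha : 0 < a) :
    Tendsto (fun n : ℕ => (2 : ℝ) ^ n * Real.exp (-(a * n ^ 2))) atTop (nhds 0) := by
  have hlin : Tendsto (fun n : ℕ => a * (n : ℝ) - Real.log 2) atTop atTop :=
    tendsto_atTop_add_const_right _ _ (tendsto_natCast_atTop_atTop.const_mul_atTop ha)
  have h := Real.tendsto_exp_neg_atTop_nhds_zero.comp
    (tendsto_natCast_atTop_atTop (R := ℝ) |>.atTop_mul_atTop₀ hlin)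
  refine h.congr fun n => ?_
  have h2 : (2 : ℝ) ^ n = Real.exp (n * Real.log 2) := by
    rw [Real.exp_nat_mul, Real.exp_log two_pos]
  rw [h2, ← Real.exp_add, Function.comp_apply]
  ring_nf

lemma tendsto_div_of_asymp {p x : ℝ} (hp : p ≠ 0) (hx : x ≠ 0) {t : ℕ → ℕ}
    (ht : Tendsto (fun n => (t n : ℝ) * x / ((n : ℝ) * p)) atTop (nhds 1)) :
    Tendsto (fun n => (t n : ℝ) / n) atTop (nhds (p / x)) := by
  have h := ht.mul_const (p / x)
  rw [one_mul] at h
  refine h.congr fun n => ?_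
  rcases eq_or_ne (n : ℝ) 0 with hn | hn
  · simp [hn]
  · field_simp

lemma tendsto_erMeasure_lt_improperChromaticNumber (p : unitInterval) {x : ℝ} {k : ℕ}
    (hp : (0 : ℝ) < p) (hx : 0 < x) (hxk : x < k) {t : ℕ → ℕ}
    (ht : Tendsto (fun n => (t n : ℝ) / n) atTop (nhds (p / x))) :
    Tendsto (fun n => (erMeasure n p).real {G | k < improperChromaticNumber G (t n)})
      atTop (nhds 0) := by
  have hk' : (0 : ℝ) < k := hx.trans hxk
  have hk : 0 < k := by exact_mod_cast hk'
  have hlt : (p : ℝ) / k < p / x := div_lt_div_of_pos_left hp hx hxk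
  obtain ⟨δ, hδ, hδlt⟩ : ∃ δ : ℝ, 0 < δ ∧ (p : ℝ) / k + 2 * δ < p / x :=
    ⟨((p : ℝ) / x - p / k) / 3, by linarith, by linarith⟩
  refine squeeze_zero' (.of_forall fun n => measureReal_nonneg) ?_
    (tendsto_nat_mul_exp_neg (a := 2 * δ ^ 2) (by positivity))
  filter_upwards [ht.eventually_const_lt hδlt, eventually_gt_atTop 0,
    (tendsto_const_div_atTop_nhds_zero_nat (p : ℝ)).eventually_lt_const hδ] with n h1 hn h2
  have hn' : (0 : ℝ) < n := by exact_mod_cast hn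
  refine erMeasure_lt_improperChromaticNumber p hδ hk ?_
  rw [lt_div_iff₀ hn'] at h1
  rw [div_lt_iff₀ hn'] at h2
  have : (p : ℝ) * (n / k + 1) = p / k * n + p := by ring
  linarith

lemma tendsto_erMeasure_improperChromaticNumber_le (p : unitInterval) {x : ℝ} {k : ℕ}
    (hp : (0 : ℝ) < p) (hkx : k < x) {t : ℕ → ℕ}
    (ht : Tendsto (fun n => (t n : ℝ) / n) atTop (nhds (p / x))) :
    Tendsto (fun n => (erMeasure n p).real {G | improperChromaticNumber G (t n) ≤ k})
      atTop (nhds 0) := by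
  rcases Nat.eq_zero_or_pos k with rfl | hk
  · refine tendsto_const_nhds.congr' ?_
    filter_upwards [eventually_gt_atTop 0] with n hn
    have : {G : SimpleGraph (Fin n) | improperChromaticNumber G (t n) ≤ 0} = ∅ := by
      ext G
      simp only [Set.mem_ofPred_eq, Set.mem_empty_iff_false, iff_false]
      intro hG
      obtain ⟨S, -, hS⟩ := exists_large_tDependent hn hG
      lia
    rw [this, measureReal_empty]
  have hk' : (0 : ℝ) < k := by exact_mod_cast hk
  have hlt : (p : ℝ) / x < p / k := div_lt_div_of_pos_left hp hk' hkx
  obtain ⟨δ, hδ, hδlt⟩ : ∃ δ : ℝ, 0 < δ ∧ (p : ℝ) / x < p / k - 2 * δ :=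
    ⟨((p : ℝ) / k - p / x) / 3, by linarith, by linarith⟩
  refine squeeze_zero' (.of_forall fun n => measureReal_nonneg) ?_
    (tendsto_two_pow_mul_exp_neg_sq (a := δ ^ 2) (by positivity))
  filter_upwards [ht.eventually_lt_const hδlt, eventually_ge_atTop (2 * k), eventually_gt_atTop 0,
    (tendsto_const_div_atTop_nhds_zero_nat (p : ℝ)).eventually_lt_const hδ] with n h1 hnk hn h2
  have hn' : (0 : ℝ) < n := by exact_mod_cast hn
  refine erMeasure_improperChromaticNumber_le p hδ hk hnk ?_
  rw [div_lt_iff₀ hn'] at h1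
  rw [div_lt_iff₀ hn'] at h2
  have : (p : ℝ) * (n / k) = p / k * n := by ring
  linarith

/-- Fix `0 < p < 1` and a non-integral real `x > 0`.  If `t(n) ~ n·p/x`
then asymptotically almost surely `χ^{t(n)}(G(n,p)) = ⌈x⌉`. -/
theorem stmt2 (p x : ℝ) (hp0 : 0 < p) (hp1 : p < 1) (hx : 0 < x)
    (hxnotint : ∀ m : ℤ, (m : ℝ) ≠ x)
    (t : ℕ → ℕ)
    (ht : Tendsto (fun n => (t n : ℝ) * x / ((n : ℝ) * p)) atTop (nhds 1)) :
    Tendsto (fun n => erMeasure n p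
        {G | (improperChromaticNumber G (t n) : ℤ) = ⌈x⌉})
      atTop (nhds 1) := by
  obtain ⟨q, rfl⟩ : ∃ q : unitInterval, (q : ℝ) = p := ⟨⟨p, hp0.le, hp1.le⟩, rfl⟩
  have ht' := tendsto_div_of_asymp hp0.ne' hx.ne' ht
  obtain ⟨k, hk⟩ : ∃ k : ℕ, ⌈x⌉ = k + 1 := by
    have := Int.ceil_pos.mpr hx
    exact ⟨(⌈x⌉ - 1).toNat, by lia⟩
  have hxk : x < (k + 1 : ℕ) := by
    have h1 : x ≤ (⌈x⌉ : ℝ) := Int.le_ceil x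
    have h2 : x ≠ (⌈x⌉ : ℝ) := (hxnotint _).symm
    have h3 := lt_of_le_of_ne h1 h2
    rw [hk] at h3
    exact_mod_cast h3
  have hkx : (k : ℝ) < x := by
    have h1 := Int.ceil_lt_add_one x
    rw [hk] at h1
    push_cast at h1
    linarith
  have hbad := (tendsto_erMeasure_lt_improperChromaticNumber q hp0 hx hxk ht').add
    (tendsto_erMeasure_improperChromaticNumber_le q hp0 hkx ht')
  rw [add_zero] at hbad
  have hcompl : Tendsto (fun n => (erMeasure n q).real
      {G | (improperChromaticNumber G (t n) : ℤ) = ⌈x⌉}ᶜ) atTop (nhds 0) := by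
    refine squeeze_zero (fun n => measureReal_nonneg) (fun n => ?_) hbad
    refine (measureReal_mono ?_ (measure_ne_top _ _)).trans (measureReal_union_le _ _)
    intro G hG
    simp only [Set.mem_compl_iff, Set.mem_ofPred_eq, hk] at hG
    simp only [Set.mem_union, Set.mem_ofPred_eq]
    lia
  have hreal := hcompl.const_sub 1
  rw [sub_zero] at hreal
  have hgood := ENNReal.tendsto_ofReal hreal
  rw [ENNReal.ofReal_one] at hgood
  refine hgood.congr fun n => ?_
  rw [← probReal_compl_eq_one_sub MeasurableSpace.measurableSet_top, compl_compl, ofReal_measureReal]
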